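/- Let q = r^2 where r is an odd prime power, and write q − 1 = e·f for positive integers e, f. Let s be a positive integer with s ∣ f and s ∣ r−1, and set D = s(r+1)/gcd(s(r+1), f). Let t be an integer with 1 ≤ t ≤ D−1 such that t·f is even. If either f/s is even and (t−1)(r+1)/2 is even, or f/s is odd and t is even, then there exists an MDS self-dual code over F_q of length t·f + 2. -/

import Mathlib

open Finset

/-- The Euclidean dual of a linear code `C ⊆ F^n`. -/
def euclideanDual {F : Type*} [Field F] {n : ℕ} (C : Submodule F (Fin n → F)) :
    Submodule F (Fin n → F) where
  carrier := {x | ∀ c ∈ C, ∑ i, x i * c i = 0}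
  add_mem' := by
    intro a b ha hb c hc
    have h : ∑ i, (a + b) i * c i = (∑ i, a i * c i) + ∑ i, b i * c i := by
      rw [← Finset.sum_add_distrib]
      exact Finset.sum_congr rfl fun i _ => by simp [add_mul]
    simp only [Set.mem_setOf_eq] at *
    rw [h, ha c hc, hb c hc, add_zero]
  zero_mem' := by
    intro c hc
    simp
  smul_mem' := by
    intro r a ha c hc
    have h : ∑ i, (r • a) i * c i = r * ∑ i, a i * c i := by
      rw [Finset.mul_sum]
      exact Finset.sum_congr rfl fun i _ => by simp [mul_assoc]
    simp only [Set.mem_setOf_eq] at *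
    rw [h, ha c hc, mul_zero]

/-- Hamming weight of a word. -/
noncomputable def hWeight {F : Type*} [Field F] {n : ℕ} (c : Fin n → F) : ℕ := Nat.card {i : Fin n // c i ≠ 0}

/-- `C` is an MDS (Euclidean) self-dual code: it equals its Euclidean dual and its
minimum Hamming distance is `n/2 + 1`. -/
def IsMDSSelfDual {F : Type*} [Field F] {n : ℕ} (C : Submodule F (Fin n → F)) : Prop :=
  C = euclideanDual C ∧
  (∀ c ∈ C, c ≠ 0 → n / 2 + 1 ≤ hWeight c) ∧
  (∃ c ∈ C, c ≠ 0 ∧ hWeight c = n / 2 + 1)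

open Classical in
/-- The quadratic character `η` of a field: `1` on nonzero squares, `-1` on nonsquares,
`0` at `0`. -/
noncomputable def quadChar (F : Type*) [Field F] (x : F) : ℤ :=
  if x = 0 then 0 else if IsSquare x then 1 else -1

open Polynomial

section ExtendedGRS

variable {F : Type*} [Field F] {n : ℕ}

theorem mem_euclideanDual {C : Submodule F (Fin n → F)} {x : Fin n → F} :
    x ∈ euclideanDual C ↔ ∀ c ∈ C, ∑ i, x i * c i = 0 :=
  Iff.rfl

theorem finrank_euclideanDual (C : Submodule F (Fin n → F)) :
    Module.finrank F (euclideanDual C) = n - Module.finrank F C := by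
  have hB : (Matrix.toBilin' (1 : Matrix (Fin n) (Fin n) F)).Nondegenerate :=
    (Matrix.nondegenerate_of_det_ne_zero (by simp)).toBilin'
  have h : euclideanDual C = (Matrix.toBilin' (1 : Matrix (Fin n) (Fin n) F)).orthogonal C := by
    ext x
    simp only [mem_euclideanDual, LinearMap.BilinForm.mem_orthogonal_iff, Matrix.toBilin'_apply',
      Matrix.one_mulVec, dotProduct]
    simp only [mul_comm]
  rw [h, LinearMap.BilinForm.finrank_orthogonal hB, Module.finrank_fin_fun]

/-- A self-orthogonal code of half the length is self-dual. -/
theorem eq_euclideanDual_of_le {C : Submodule F (Fin n → F)} (h : C ≤ euclideanDual C)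
    (hn : n = 2 * Module.finrank F C) : C = euclideanDual C :=
  Submodule.eq_of_le_of_finrank_eq h (by rw [finrank_euclideanDual]; omega)

/-- The encoder of the extended generalized Reed-Solomon code: evaluation at the points `v`
with column multipliers `w`, followed by the coefficient of `X ^ m`. -/
noncomputable def extendedGRS (m : ℕ) (v w : Fin n → F) : F[X] →ₗ[F] (Fin (n + 1) → F) where
  toFun g := Fin.snoc (fun i => w i * g.eval (v i)) (g.coeff m)
  map_add' g h := by
    ext i
    refine Fin.lastCases ?_ (fun i => ?_) i <;> simp [mul_add]
  map_smul' c g := by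
    ext i
    refine Fin.lastCases ?_ (fun i => ?_) i <;> simp [mul_left_comm]

@[simp]
theorem extendedGRS_castSucc (m : ℕ) (v w : Fin n → F) (g : F[X]) (i : Fin n) :
    extendedGRS m v w g i.castSucc = w i * g.eval (v i) := by
  simp [extendedGRS]

@[simp]
theorem extendedGRS_last (m : ℕ) (v w : Fin n → F) (g : F[X]) :
    extendedGRS m v w g (Fin.last n) = g.coeff m := by
  simp [extendedGRS]

open Classical in
theorem hWeight_extendedGRS (m : ℕ) (v w : Fin n → F) (hw : ∀ i, w i ≠ 0) (g : F[X]) :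
    hWeight (extendedGRS m v w g) =
      (n - #{i | g.eval (v i) = 0}) + if g.coeff m = 0 then 0 else 1 := by
  have h := Finset.card_filter_add_card_filter_not (s := (univ : Finset (Fin n)))
    (fun i => g.eval (v i) = 0)
  rw [card_univ, Fintype.card_fin] at h
  rw [hWeight, Nat.card_eq_fintype_card, Fintype.card_subtype, Finset.card_filter,
    Fin.sum_univ_castSucc]
  simp only [extendedGRS_castSucc, extendedGRS_last, mul_ne_zero_iff, hw, ne_eq,
    not_false_eq_true, true_and]
  rw [← Finset.card_filter, ite_not]
  omega

open Classical in
theorem card_eval_eq_zero_le {v : Fin n → F} (hv : Function.Injective v) {g : F[X]}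
    (hg : g ≠ 0) : #{i | g.eval (v i) = 0} ≤ g.natDegree := by
  rw [← Finset.card_image_of_injective _ hv]
  refine Polynomial.card_le_degree_of_subset_roots fun a ha => ?_
  simp only [image_val, Multiset.mem_dedup, Multiset.mem_map] at ha
  obtain ⟨i, hi, rfl⟩ := ha
  simpa [hg] using hi

variable {m : ℕ} {v w : Fin n → F}

theorem lt_hWeight_extendedGRS (hn : n = 2 * m + 1) (hv : Function.Injective v)
    (hw : ∀ i, w i ≠ 0) {g : F[X]} (hg : g ≠ 0) (hdeg : g.degree < (m + 1 : ℕ)) :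
    m + 2 ≤ hWeight (extendedGRS m v w g) := by
  classical
  have hd : g.natDegree < m + 1 := (natDegree_lt_iff_degree_lt hg).2 hdeg
  have h := card_eval_eq_zero_le hv hg
  rw [hWeight_extendedGRS m v w hw]
  split_ifs with h0
  · have : g.natDegree ≠ m := fun hm => hg (leadingCoeff_eq_zero.1 (by rw [leadingCoeff, hm, h0]))
    omega
  · omega

theorem sum_extendedGRS_mul (hn : n = 2 * m + 1) (hv : Function.Injective v)
    (hw : ∀ i, w i ^ 2 = -(∏ j ∈ univ.erase i, (v i - v j))⁻¹) {g h : F[X]}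
    (hg : g.degree < (m + 1 : ℕ)) (hh : h.degree < (m + 1 : ℕ)) :
    ∑ i, extendedGRS m v w g i * extendedGRS m v w h i = 0 := by
  have hg' : g.natDegree ≤ m := natDegree_le_iff_coeff_eq_zero.2
    fun N hN => (degree_lt_iff_coeff_zero _ _).1 hg N hN
  have hh' : h.natDegree ≤ m := natDegree_le_iff_coeff_eq_zero.2
    fun N hN => (degree_lt_iff_coeff_zero _ _).1 hh N hN
  have key := Lagrange.coeff_eq_sum (s := univ) (v := v) hv.injOn (P := g * h) (by
    refine (degree_le_of_natDegree_le (natDegree_mul_le_of_le hg' hh')).trans_lt ?_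
    rw [card_univ, Fintype.card_fin]
    exact_mod_cast (by omega : m + m < n))
  rw [card_univ, Fintype.card_fin, show n - 1 = m + m by omega, coeff_mul_add_eq_of_natDegree_le hg' hh']
    at key
  rw [Fin.sum_univ_castSucc]
  simp only [extendedGRS_castSucc, extendedGRS_last]
  rw [key, ← Finset.sum_add_distrib]
  refine Finset.sum_eq_zero fun i _ => ?_
  rw [mul_mul_mul_comm, ← sq, hw, eval_mul]
  ring

theorem exists_isMDSSelfDual_of_sq_eq (hn : n = 2 * m + 1) (hv : Function.Injective v)
    (hw : ∀ i, w i ^ 2 = -(∏ j ∈ univ.erase i, (v i - v j))⁻¹) :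
    ∃ C : Submodule F (Fin (n + 1) → F), IsMDSSelfDual C := by
  classical
  have hw0 : ∀ i, w i ≠ 0 := fun i hi => by
    have h := hw i
    rw [hi, zero_pow two_ne_zero, zero_eq_neg, inv_eq_zero, prod_eq_zero_iff] at h
    obtain ⟨j, hj, hij⟩ := h
    exact (mem_erase.1 hj).1 (hv (sub_eq_zero.1 hij)).symm
  set E := extendedGRS m v w
  have hinj : Function.Injective (E.domRestrict (degreeLT F (m + 1))) := by
    rw [injective_iff_map_eq_zero]
    intro g hg
    by_contra h0
    have h := lt_hWeight_extendedGRS hn hv hw0 (g := g.1) (by simpa using h0) (mem_degreeLT.1 g.2)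
    have hg' : extendedGRS m v w g.1 = 0 := hg
    simp [hg', hWeight] at h
  have hrank : Module.finrank F ((degreeLT F (m + 1)).map E) = m + 1 := by
    rw [← LinearMap.range_domRestrict, LinearMap.finrank_range_of_inj hinj,
      (degreeLTEquiv F (m + 1)).finrank_eq, Module.finrank_fin_fun]
  refine ⟨(degreeLT F (m + 1)).map E, eq_euclideanDual_of_le ?_ (by omega), ?_, ?_⟩
  · rintro _ ⟨g, hg, rfl⟩ _ ⟨h, hh, rfl⟩
    exact sum_extendedGRS_mul hn hv hw (mem_degreeLT.1 hg) (mem_degreeLT.1 hh)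
  · rintro _ ⟨g, hg, rfl⟩ h0
    have := lt_hWeight_extendedGRS hn hv hw0 (g := g) (by rintro rfl; simp at h0)
      (mem_degreeLT.1 hg)
    exact le_trans (by omega) this
  · obtain ⟨T, -, hT⟩ := Finset.exists_subset_card_eq (s := (univ : Finset (Fin n))) (n := m)
      (by rw [card_univ, Fintype.card_fin]; omega)
    set g := Lagrange.nodal T v
    have hg : g ≠ 0 := Lagrange.nodal_ne_zero
    have hgd : g.degree < (m + 1 : ℕ) := by
      rw [Lagrange.degree_nodal, hT]; exact_mod_cast Nat.lt_succ_self m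
    have hle : hWeight (E g) ≤ m + 2 := by
      have h : m ≤ #{i | g.eval (v i) = 0} := hT ▸ Finset.card_le_card fun i hi => by
        simpa using Lagrange.eval_nodal_at_node hi
      rw [hWeight_extendedGRS m v w hw0]
      split_ifs <;> omega
    have hge := lt_hWeight_extendedGRS hn hv hw0 hg hgd
    refine ⟨E g, ⟨g, mem_degreeLT.2 hgd, rfl⟩, fun h0 => ?_, ?_⟩
    · have hg' : extendedGRS m v w g = 0 := h0
      simp [hg', hWeight] at hge
    · rw [le_antisymm hle hge]
      omega

/-- If `-δ_S(a)` is a square for every `a ∈ S`, where `δ_S(a) = ∏ (a - b)` over the other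
elements `b` of `S`, and `S` has odd size `n`, there is an MDS self-dual code of length `n + 1`. -/
theorem exists_isMDSSelfDual_of_isSquare [DecidableEq F] (S : Finset F) (hS : #S = n)
    (hn : Odd n) (h : ∀ a ∈ S, IsSquare (-∏ b ∈ S.erase a, (a - b))) :
    ∃ C : Submodule F (Fin (n + 1) → F), IsMDSSelfDual C := by
  obtain ⟨m, hm⟩ := hn
  let φ : Fin n ≃ S := (S.equivFinOfCardEq hS).symm
  have hv : Function.Injective (fun i => (φ i : F)) :=
    Subtype.val_injective.comp φ.injective
  have hprod : ∀ i, ∏ j ∈ univ.erase i, ((φ i : F) - φ j) = ∏ b ∈ S.erase (φ i), ((φ i : F) - b) := by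
    intro i
    refine Finset.prod_bij (fun j _ => (φ j : F)) ?_ (fun _ _ _ _ h => hv h) ?_ (fun _ _ => rfl)
    · intro j hj
      exact mem_erase.2 ⟨fun h => (mem_erase.1 hj).1 (hv h), (φ j).2⟩
    · intro b hb
      refine ⟨φ.symm ⟨b, mem_of_mem_erase hb⟩, ?_, by simp⟩
      simp only [mem_erase, mem_univ, and_true]
      intro hi
      simp [← hi] at hb
  choose y hy using fun i => h (φ i) (φ i).2
  refine exists_isMDSSelfDual_of_sq_eq (v := fun i => (φ i : F)) (w := fun i => (y i)⁻¹) hm hv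
    fun i => ?_
  rw [hprod, neg_inv, hy i, inv_pow, sq]

end ExtendedGRS

section PowerFibers

theorem prod_sub_eq_eval_derivative_nodal {F : Type*} [Field F] [DecidableEq F]
    {S : Finset F} {a : F} (ha : a ∈ S) :
    ∏ b ∈ S.erase a, (a - b) = (derivative (Lagrange.nodal S id)).eval a := by
  have h := Lagrange.eval_nodal_derivative_eval_node_eq (v := (id : F → F)) ha
  rw [Lagrange.eval_nodal] at h
  exact h.symm

variable {F : Type*} [Field F] [Fintype F] [DecidableEq F] {f : ℕ} {ζ : F}

theorem prod_X_sub_C_filter_pow_eq (hζ : IsPrimitiveRoot ζ f) (hf : (f : F) ≠ 0) {γ : F}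
    (hγ : γ ≠ 0) (hα : ∃ α, α ^ f = γ) :
    ∏ a with a ^ f = γ, (X - C a) = X ^ f - C γ := by
  have hpos : 0 < f := Nat.pos_of_ne_zero (by rintro rfl; simp at hf)
  have hnd : (nthRoots f γ).Nodup := nodup_roots (separable_X_pow_sub_C γ hf hγ)
  have hset : ({a | a ^ f = γ} : Finset F) = (nthRoots f γ).toFinset := by
    ext a
    simp [mem_nthRoots hpos]
  rw [hset, Finset.prod, Multiset.toFinset_val, hnd.dedup]
  refine prod_multiset_X_sub_C_of_monic_of_roots_card_eq (monic_X_pow_sub_C γ hpos.ne') ?_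
  rw [natDegree_X_pow_sub_C]
  exact (hζ.card_nthRoots γ).trans (if_pos hα)

/-- The set consisting of `0` and all elements whose `f`-th power lies in `Γ`. -/
def insertZeroPowFiber (f : ℕ) (Γ : Finset F) : Finset F :=
  insert 0 (univ.filter fun a => a ^ f ∈ Γ)

variable {Γ : Finset F}

theorem nodal_insertZeroPowFiber (hζ : IsPrimitiveRoot ζ f) (hf : (f : F) ≠ 0)
    (h0 : (0 : F) ∉ Γ) (hΓ : ∀ γ ∈ Γ, ∃ α, α ^ f = γ) :
    Lagrange.nodal (insertZeroPowFiber f Γ) id = X * ∏ γ ∈ Γ, (X ^ f - C γ) := by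
  have hpos : f ≠ 0 := by rintro rfl; simp at hf
  rw [Lagrange.nodal_eq, insertZeroPowFiber, prod_insert (by simpa [hpos] using h0)]
  simp only [id, C_0, sub_zero]
  rw [← Finset.prod_fiberwise_of_maps_to (t := Γ) (g := fun a => a ^ f) (by simp)]
  congr 1
  refine prod_congr rfl fun γ hγ => ?_
  rw [← prod_X_sub_C_filter_pow_eq hζ hf (ne_of_mem_of_not_mem hγ h0) (hΓ γ hγ), filter_filter]
  refine prod_congr (filter_congr fun a _ => ?_) fun _ _ => rfl
  exact ⟨fun h => h.2, fun h => ⟨h ▸ hγ, h⟩⟩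

theorem card_insertZeroPowFiber (hζ : IsPrimitiveRoot ζ f) (hf : (f : F) ≠ 0)
    (h0 : (0 : F) ∉ Γ) (hΓ : ∀ γ ∈ Γ, ∃ α, α ^ f = γ) :
    #(insertZeroPowFiber f Γ) = #Γ * f + 1 := by
  have hpos : f ≠ 0 := by rintro rfl; simp at hf
  rw [← Lagrange.natDegree_nodal (v := id), nodal_insertZeroPowFiber hζ hf h0 hΓ,
    natDegree_X_mul (prod_ne_zero_iff.2 fun γ _ => X_pow_sub_C_ne_zero (Nat.pos_of_ne_zero hpos) γ),
    natDegree_prod_of_monic _ _ fun γ _ => monic_X_pow_sub_C γ hpos]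
  simp

theorem prod_sub_insertZeroPowFiber_zero (hζ : IsPrimitiveRoot ζ f) (hf : (f : F) ≠ 0)
    (h0 : (0 : F) ∉ Γ) (hΓ : ∀ γ ∈ Γ, ∃ α, α ^ f = γ) :
    ∏ b ∈ (insertZeroPowFiber f Γ).erase 0, (0 - b) = ∏ γ ∈ Γ, -γ := by
  have hpos : f ≠ 0 := by rintro rfl; simp at hf
  rw [prod_sub_eq_eval_derivative_nodal (by simp [insertZeroPowFiber]),
    nodal_insertZeroPowFiber hζ hf h0 hΓ, derivative_mul]
  simp [eval_prod, hpos]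

theorem prod_sub_insertZeroPowFiber (hζ : IsPrimitiveRoot ζ f) (hf : (f : F) ≠ 0)
    (h0 : (0 : F) ∉ Γ) (hΓ : ∀ γ ∈ Γ, ∃ α, α ^ f = γ) {a : F} (ha : a ^ f ∈ Γ) :
    ∏ b ∈ (insertZeroPowFiber f Γ).erase a, (a - b) =
      f * a ^ f * ∏ γ ∈ Γ.erase (a ^ f), (a ^ f - γ) := by
  have hpos : f ≠ 0 := by rintro rfl; simp at hf
  rw [prod_sub_eq_eval_derivative_nodal (by simp [insertZeroPowFiber, ha]),
    nodal_insertZeroPowFiber hζ hf h0 hΓ, ← mul_prod_erase Γ _ ha]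
  simp only [derivative_mul, derivative_X, derivative_sub, derivative_X_pow, derivative_C,
    eval_add, eval_mul, eval_sub, eval_pow, eval_X, eval_C, eval_prod, sub_self, eval_one,
    sub_zero, zero_mul, mul_zero, zero_add, add_zero, map_natCast, eval_natCast]
  rw [← mul_assoc, mul_left_comm a, mul_pow_sub_one hpos]

end PowerFibers

section QuadraticExtension

variable {F : Type*} [Field F] {p k r : ℕ} [CharP F p]

theorem pow_half_sub_mul [Fact p.Prime] (hr : r = p ^ k) (hr0 : r ≠ 0) {a b : F}
    (ha : a ^ (r + 1) = 1) (hb : b ^ (r + 1) = 1) (hab : a ≠ b) (h : ℕ) :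
    (a - b) ^ ((r - 1) * h) * (a ^ h * b ^ h) = (-1) ^ h := by
  rw [pow_mul, ← mul_pow, ← mul_pow]
  congr 1
  refine mul_left_cancel₀ (sub_ne_zero.2 hab) ?_
  rw [← mul_assoc, mul_pow_sub_one hr0]
  have hsub : (a - b) ^ r = a ^ r - b ^ r := by
    rw [hr]; exact sub_pow_char_pow ..
  rw [pow_succ] at ha hb
  rw [hsub]
  linear_combination b * ha - a * hb

variable [Fintype F]

theorem isSquare_of_pow_eq_one (hodd : Odd r) (hF : Fintype.card F = r ^ 2) {a : F}
    (ha : a ^ ((r - 1) * ((r + 1) / 2)) = 1) : IsSquare a := by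
  obtain ⟨u, rfl⟩ := hodd
  rcases eq_or_ne a 0 with rfl | h0
  · exact .zero
  have hchar : ringChar F ≠ 2 := by
    rw [ne_eq, FiniteField.even_card_iff_char_two, hF, ← Nat.even_iff, Nat.not_even_iff_odd]
    exact (odd_two_mul_add_one u).pow
  rw [FiniteField.isSquare_iff hchar h0, hF, ← ha]
  congr 1
  rw [show 2 * u + 1 - 1 = 2 * u by omega, show (2 * u + 1 + 1) / 2 = u + 1 by omega,
    show (2 * u + 1) ^ 2 = 2 * (2 * u * (u + 1)) + 1 by ring]
  omega

theorem isSquare_natCast [Fact p.Prime] (hr : r = p ^ k) (hodd : Odd r)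
    (hF : Fintype.card F = r ^ 2) (n : ℕ) : IsSquare (n : F) := by
  rcases eq_or_ne (n : F) 0 with h0 | h0
  · exact h0 ▸ .zero
  refine isSquare_of_pow_eq_one hodd hF ?_
  rw [pow_mul]
  have h : (n : F) ^ r = n := by
    rw [hr, ← iterateFrobenius_def, map_natCast]
  rw [← mul_pow_sub_one hodd.pos.ne', mul_eq_left₀ h0] at h
  rw [h, one_pow]

theorem isSquare_of_pow_succ_eq_one (hodd : Odd r) (hF : Fintype.card F = r ^ 2) {a : F}
    (ha : a ^ (r + 1) = 1) : IsSquare a := by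
  refine isSquare_of_pow_eq_one hodd hF ?_
  obtain ⟨u, rfl⟩ := hodd
  rw [show (2 * u + 1 - 1) * ((2 * u + 1 + 1) / 2) = (2 * u + 1 + 1) * u by
    rw [show 2 * u + 1 - 1 = 2 * u by omega, show (2 * u + 1 + 1) / 2 = u + 1 by omega]
    ring, pow_mul, ha, one_pow]

theorem isSquare_neg_one (hodd : Odd r) (hF : Fintype.card F = r ^ 2) : IsSquare (-1 : F) :=
  isSquare_of_pow_succ_eq_one hodd hF hodd.add_one.neg_one_pow

theorem isSquare_prod_erase_sub [DecidableEq F] [Fact p.Prime] (hr : r = p ^ k) (hodd : Odd r)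
    (hF : Fintype.card F = r ^ 2) {Γ : Finset F} (hΓ : ∀ γ ∈ Γ, γ ^ (r + 1) = 1) {γ₀ : F}
    (hγ₀ : γ₀ ∈ Γ)
    (h : (γ₀ ^ ((r + 1) / 2)) ^ #Γ * ∏ γ ∈ Γ, γ ^ ((r + 1) / 2) =
      (-1) ^ ((r + 1) / 2 * (#Γ - 1))) :
    IsSquare (∏ γ ∈ Γ.erase γ₀, (γ₀ - γ)) := by
  refine isSquare_of_pow_eq_one hodd hF ?_
  set l := (r + 1) / 2
  have hl : r + 1 = l * 2 := by have := hodd.add_one.two_dvd; omega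
  have hε : γ₀ ^ l * γ₀ ^ l = 1 := by rw [← sq, ← pow_mul, ← hl, hΓ _ hγ₀]
  have hcard : #Γ ≠ 0 := (card_pos.2 ⟨_, hγ₀⟩).ne'
  have hprod : ∏ γ ∈ Γ.erase γ₀, ((γ₀ - γ) ^ ((r - 1) * l) * (γ₀ ^ l * γ ^ l)) =
      (-1) ^ (l * (#Γ - 1)) := by
    rw [pow_mul, ← card_erase_of_mem hγ₀]
    refine prod_eq_pow_card fun γ hγ => ?_
    obtain ⟨hne, hmem⟩ := mem_erase.1 hγ
    exact pow_half_sub_mul hr hodd.pos.ne' (hΓ _ hγ₀) (hΓ _ hmem) hne.symm l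
  rw [prod_mul_distrib, prod_mul_distrib, prod_const, card_erase_of_mem hγ₀, prod_pow] at hprod
  rw [← mul_prod_erase Γ _ hγ₀, ← mul_pow_sub_one hcard] at h
  have h' : (γ₀ ^ l) ^ (#Γ - 1) * ∏ γ ∈ Γ.erase γ₀, γ ^ l = (-1) ^ (l * (#Γ - 1)) := by
    rw [← h]
    linear_combination (-(γ₀ ^ l) ^ (#Γ - 1) * ∏ γ ∈ Γ.erase γ₀, γ ^ l) * hε
  rw [h'] at hprod
  exact (mul_eq_right₀ (pow_ne_zero _ (neg_ne_zero.2 one_ne_zero))).1 hprod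

theorem exists_isMDSSelfDual_of_powFiber [DecidableEq F] [Fact p.Prime] (hr : r = p ^ k)
    (hodd : Odd r) (hF : Fintype.card F = r ^ 2) {f : ℕ} {ζ : F} (hζ : IsPrimitiveRoot ζ f)
    (hf : (f : F) ≠ 0) {Γ : Finset F} (hroot : ∀ γ ∈ Γ, ∃ α, α ^ f = γ)
    (hΓ : ∀ γ ∈ Γ, γ ^ (r + 1) = 1) (heven : Even (#Γ * f))
    (h : ∀ γ₀ ∈ Γ, (γ₀ ^ ((r + 1) / 2)) ^ #Γ * ∏ γ ∈ Γ, γ ^ ((r + 1) / 2) =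
      (-1) ^ ((r + 1) / 2 * (#Γ - 1))) :
    ∃ C : Submodule F (Fin (#Γ * f + 2) → F), IsMDSSelfDual C := by
  have h0 : (0 : F) ∉ Γ := fun h0 => by simpa using hΓ 0 h0
  have hneg := isSquare_neg_one hodd hF
  refine exists_isMDSSelfDual_of_isSquare (insertZeroPowFiber f Γ)
    (card_insertZeroPowFiber hζ hf h0 hroot) heven.add_one fun a ha => ?_
  rw [← neg_one_mul]
  refine hneg.mul ?_
  rcases mem_insert.1 ha with rfl | ha
  · rw [prod_sub_insertZeroPowFiber_zero hζ hf h0 hroot]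
    refine Finset.isSquare_prod _ fun γ hγ => ?_
    rw [← neg_one_mul]
    exact hneg.mul (isSquare_of_pow_succ_eq_one hodd hF (hΓ γ hγ))
  · have ha : a ^ f ∈ Γ := by simpa using ha
    rw [prod_sub_insertZeroPowFiber hζ hf h0 hroot ha]
    exact ((isSquare_natCast hr hodd hF f).mul
      (isSquare_of_pow_succ_eq_one hodd hF (hΓ _ ha))).mul
      (isSquare_prod_erase_sub hr hodd hF hΓ ha (h _ ha))

end QuadraticExtension

section Exponents

theorem prod_range_two_mul_neg_one_pow {R : Type*} [CommRing R] (u : ℕ) :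
    ∏ i ∈ range (2 * u), (-1 : R) ^ i = (-1) ^ u := by
  induction u with
  | zero => simp
  | succ u ih =>
    rw [show 2 * (u + 1) = 2 * u + 1 + 1 by ring, prod_range_succ, prod_range_succ, ih, pow_succ,
      pow_succ, pow_mul]
    simp

/-- Both signs occur as `∏ i ∈ I, (-1) ^ i` with `I` of a given even size. -/
theorem exists_card_eq_prod_neg_one_pow {R : Type*} [CommRing R] {t D : ℕ} (ht : 1 ≤ t)
    (heven : Even t) (htD : t < D) (l : ℕ) :
    ∃ I ⊆ range D, #I = t ∧ ∏ i ∈ I, (-1 : R) ^ i = (-1) ^ l := by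
  obtain ⟨u, rfl⟩ := even_iff_two_dvd.1 heven
  by_cases h : ((-1 : R) ^ u = (-1) ^ l)
  · exact ⟨range (2 * u), range_subset_range.2 htD.le, card_range _,
      (prod_range_two_mul_neg_one_pow u).trans h⟩
  · obtain ⟨v, rfl⟩ : ∃ v, u = v + 1 := ⟨u - 1, by omega⟩
    have hv : 2 * (v + 1) ∉ range (2 * v + 1) := by simp
    refine ⟨insert (2 * (v + 1)) (range (2 * v + 1)), ?_, ?_, ?_⟩
    · intro i hi
      simp only [mem_insert, mem_range] at hi ⊢
      omega
    · rw [card_insert_of_notMem hv, card_range]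
      ring
    · rw [prod_insert hv, prod_range_succ, prod_range_two_mul_neg_one_pow]
      rw [pow_succ] at h
      rcases neg_one_pow_eq_or R v with hv | hv <;> rcases neg_one_pow_eq_or R l with hl | hl <;>
        simp_all [pow_mul]

theorem exists_index_set {R : Type*} [CommRing R] {t D r g : ℕ} {ε : R} (hε : ε = (-1) ^ g)
    (hodd : Odd r) (ht : 1 ≤ t) (htD : t < D)
    (hcond : (Even g ∧ Even ((t - 1) * (r + 1) / 2)) ∨ (¬ Even g ∧ Even t)) :
    ∃ I ⊆ range D, #I = t ∧
      ∀ i, (ε ^ i) ^ t * ∏ j ∈ I, ε ^ j = (-1) ^ ((r + 1) / 2 * (t - 1)) := by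
  rcases hcond with ⟨hg, h⟩ | ⟨hg, h⟩
  · rw [Nat.mul_div_assoc _ hodd.add_one.two_dvd, mul_comm] at h
    refine ⟨range t, range_subset_range.2 htD.le, card_range t, fun i => ?_⟩
    rw [hε, hg.neg_one_pow, h.neg_one_pow]
    simp
  · obtain ⟨I, hI, hcard, hprod⟩ :=
      exists_card_eq_prod_neg_one_pow (R := R) ht h htD ((r + 1) / 2 * (t - 1))
    refine ⟨I, hI, hcard, fun i => ?_⟩
    rw [hε, (Nat.not_even_iff_odd.1 hg).neg_one_pow, hprod, ← pow_mul, (h.mul_left i).neg_one_pow,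
      one_mul]

end Exponents

theorem stmt_16 (r e f s t p k : ℕ) (hp : p.Prime) (hpodd : Odd p) (hr : r = p ^ k)
    (hk : 0 < k) (he : 0 < e) (hf : 0 < f) (heq : r ^ 2 - 1 = e * f)
    (hs : 0 < s) (hsf : s ∣ f) (hsr : s ∣ r - 1)
    (ht1 : 1 ≤ t) (ht2 : t ≤ s * (r + 1) / Nat.gcd (s * (r + 1)) f - 1)
    (htf : Even (t * f))
    (hcond : (Even (f / s) ∧ Even ((t - 1) * (r + 1) / 2)) ∨ (¬ Even (f / s) ∧ Even t))
    (F : Type*) [Field F] [Fintype F] (hF : Fintype.card F = r ^ 2) :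
    ∃ C : Submodule F (Fin (t * f + 2) → F), IsMDSSelfDual C := by
  classical
  have : Fact p.Prime := ⟨hp⟩
  have hodd : Odd r := hr ▸ hpodd.pow
  have hr1 : 1 < r := hr ▸ Nat.one_lt_pow hk.ne' hp.one_lt
  have : CharP F p := charP_of_card_eq_prime_pow (f := k * 2) (by rw [hF, hr, pow_mul])
  obtain ⟨θ, hθ⟩ := IsCyclic.exists_generator (α := Fˣ)
  have hord : orderOf θ = r ^ 2 - 1 := by
    rw [orderOf_eq_card_of_forall_mem_zpowers hθ, Nat.card_eq_fintype_card, Fintype.card_units, hF]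
  obtain ⟨m, hm⟩ := hsr
  obtain ⟨g, rfl⟩ := hsf
  rw [Nat.mul_div_cancel_left _ hs] at hcond
  have hm0 : 0 < m := Nat.pos_of_ne_zero (by rintro rfl; omega)
  have hsq : r ^ 2 - 1 = s * (r + 1) * m := by
    rw [mul_right_comm, ← hm, ← one_pow 2, Nat.sq_sub_sq, mul_comm, one_pow]
  have hfF : ((s * g : ℕ) : F) ≠ 0 := by
    intro h
    have h1 : ((e * (s * g) + 1 : ℕ) : F) = 0 := by
      rw [← heq, Nat.sub_add_cancel (Nat.one_le_pow _ _ (by omega)), ← hF, Nat.cast_card_eq_zero]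
    rw [Nat.cast_add, Nat.cast_mul, h] at h1
    simp at h1
  have hζ : IsPrimitiveRoot ((θ ^ e : Fˣ) : F) (s * g) :=
    IsPrimitiveRoot.coe_units_iff.2
      ((IsPrimitiveRoot.orderOf θ).pow (by rw [hord, hsq]; positivity) (hord.trans heq))
  set ω : Fˣ := θ ^ (s * g * m) with hω
  have hordω : orderOf ω = s * (r + 1) / Nat.gcd (s * (r + 1)) (s * g) := by
    rw [hω, orderOf_pow, hord, hsq, Nat.gcd_mul_right, Nat.mul_div_mul_right _ _ hm0]
  have hωr : ω ^ (r + 1) = 1 := by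
    rw [hω, ← pow_mul, show s * g * m * (r + 1) = (r ^ 2 - 1) * g by rw [hsq]; ring, pow_mul,
      ← hord, pow_orderOf_eq_one, one_pow]
  have hhalf : ((θ ^ ((r - 1) * ((r + 1) / 2)) : Fˣ) : F) = -1 := by
    have h2 : (r - 1) * ((r + 1) / 2) * 2 = r ^ 2 - 1 := by
      rw [mul_assoc, Nat.div_mul_cancel hodd.add_one.two_dvd, hsq, hm]
      ring
    have hpos : 0 < (r - 1) * ((r + 1) / 2) :=
      Nat.mul_pos (by omega) (by omega)
    have h1 : ((θ ^ ((r - 1) * ((r + 1) / 2)) : Fˣ) : F) ^ 2 = 1 := by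
      rw [← Units.val_pow_eq_pow_val, ← pow_mul, h2, ← hord, pow_orderOf_eq_one, Units.val_one]
    refine (mul_self_eq_one_iff.1 ((sq _).symm.trans h1)).resolve_left fun h => ?_
    have := Nat.le_of_dvd hpos (orderOf_dvd_of_pow_eq_one (Units.val_eq_one.1 h))
    omega
  have hε : (ω : F) ^ ((r + 1) / 2) = (-1) ^ g := by
    rw [← hhalf, ← Units.val_pow_eq_pow_val, ← Units.val_pow_eq_pow_val, hω, ← pow_mul, ← pow_mul,
      hm]
    congr 2
    ring
  obtain ⟨I, hI, rfl, hsign⟩ := exists_index_set hε hodd ht1 (D := orderOf ω) (by omega) hcond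
  have hinj : Set.InjOn (fun i => (ω : F) ^ i) I := fun i hi j hj hij =>
    pow_injOn_Iio_orderOf (mem_range.1 (hI hi)) (mem_range.1 (hI hj))
      (Units.ext (by simpa using hij))
  have hcard : #(I.image fun i => (ω : F) ^ i) = #I := card_image_of_injOn hinj
  rw [← hcard] at htf ⊢
  refine exists_isMDSSelfDual_of_powFiber hr hodd hF hζ hfF ?_ ?_ htf ?_
  · simp only [mem_image]
    rintro _ ⟨i, -, rfl⟩
    refine ⟨(θ : F) ^ (m * i), ?_⟩
    rw [hω, Units.val_pow_eq_pow_val, ← pow_mul, ← pow_mul]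
    congr 1
    ring
  · simp only [mem_image]
    rintro _ ⟨i, -, rfl⟩
    rw [pow_right_comm, ← Units.val_pow_eq_pow_val, hωr, Units.val_one, one_pow]
  · simp only [mem_image]
    rintro _ ⟨i, -, rfl⟩
    rw [prod_image hinj, hcard, ← hsign i]
    simp only [pow_right_comm _ _ ((r + 1) / 2)]
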